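/- Let C be a Cayley algebra over F, T := T(C⊗C) the Smirnov algebra with involution, G an abelian group, and Γ: C = ⊕_{g∈G} C_g a G-grading on C. For g ∈ G set T_g := T ∩ (Σ_{g₁,g₂∈G, g₁+g₂=g} C_{g₁}⊗C_{g₂}). Then T = ⊕_{g∈G} T_g is an involution preserving G-grading on T(C⊗C), and its degree map satisfies deg(s⊗1 + 1⊗s) = deg_Γ(s) and deg(s₁⊗s₂ + s₂⊗s₁ − n(s₁,s₂)·1⊗1) = deg_Γ(s₁) + deg_Γ(s₂) for all Γ-homogeneous elements s, s₁, s₂ ∈ C₀. -/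

import Mathlib

open scoped TensorProduct

noncomputable section

/-- A `G`-grading on a (not necessarily associative or unital) `F`-algebra `A`:
a direct-sum decomposition `A = ⊕_{g ∈ G} A_g` (independent components whose sum is
everything) with `A_g · A_h ⊆ A_{g+h}`. -/
def IsGrading (F : Type*) [Field F] {G : Type*} [AddCommGroup G] {A : Type*}
    [NonUnitalNonAssocRing A] [Module F A] (𝒜 : G → Submodule F A) : Prop :=
  (∀ g : G, Disjoint (𝒜 g) (⨆ h : G, ⨆ _ : h ≠ g, 𝒜 h)) ∧
    (⨆ g : G, 𝒜 g) = ⊤ ∧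
    ∀ ⦃g h : G⦄ ⦃x y : A⦄, x ∈ 𝒜 g → y ∈ 𝒜 h → x * y ∈ 𝒜 (g + h)

/-- A subspace `V` is graded when `V = ⊕_{g ∈ G} (V ∩ A_g)`. -/
def IsGradedSubspace (F : Type*) [Field F] {G : Type*} [AddCommGroup G] {A : Type*}
    [NonUnitalNonAssocRing A] [Module F A] (𝒜 : G → Submodule F A)
    (V : Submodule F A) : Prop :=
  V = ⨆ g : G, V ⊓ 𝒜 g

/-- A Hurwitz algebra structure: `n` is a multiplicative quadratic form whose polar
form is nondegenerate, on a finite-dimensional unital (not necessarily associative)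
`F`-algebra `B`. -/
def IsHurwitz (F : Type*) [Field F] {B : Type*} [NonAssocRing B] [Module F B]
    (n : QuadraticForm F B) : Prop :=
  FiniteDimensional F B ∧
    (∀ x : B, (∀ y : B, QuadraticMap.polar n x y = 0) → x = 0) ∧
    (∀ x y : B, n (x * y) = n x * n y)

/-- The standard conjugation `x ↦ n(x,1)·1 - x` of a Hurwitz algebra, as a linear map. -/
def hconj (F : Type*) [Field F] {B : Type*} [NonAssocRing B] [Module F B]
    (n : QuadraticForm F B) : B →ₗ[F] B where
  toFun x := QuadraticMap.polar n x 1 • (1 : B) - x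
  map_add' x y := by
    simp only [QuadraticMap.polar_add_left, add_smul]
    abel
  map_smul' c x := by
    simp [QuadraticMap.polar_smul_left, smul_sub, mul_smul]

/-- The subspace `B₀ = {x ∈ B : x̄ = -x}` of skew elements of a Hurwitz algebra. -/
def skewPart (F : Type*) [Field F] {B : Type*} [NonAssocRing B] [Module F B]
    (n : QuadraticForm F B) : Submodule F B where
  carrier := {x | hconj F n x = -x}
  add_mem' := by
    intro a b ha hb
    simp only [Set.mem_setOf_eq, map_add] at *
    rw [ha, hb]; abel
  zero_mem' := by simp
  smul_mem' := by
    intro c x hx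
    simp only [Set.mem_setOf_eq, map_smul] at *
    rw [hx, smul_neg]

/-- The subspace `p ⊗ q` of `C ⊗ B`, for subspaces `p ⊆ C`, `q ⊆ B`. -/
def tsub (F : Type*) [Field F] {C B : Type*} [NonAssocRing C] [Module F C]
    [NonAssocRing B] [Module F B] (p : Submodule F C) (q : Submodule F B) :
    Submodule F (C ⊗[F] B) :=
  LinearMap.range (TensorProduct.map p.subtype q.subtype)

/-- The Smirnov algebra `T(C⊗C) = span{ a⊗a - n(a)·1⊗1 : a ∈ C } ⊆ C ⊗ C`. -/
def smirnovT (F : Type*) [Field F] {C : Type*} [NonAssocRing C] [Module F C]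
    (n : QuadraticForm F C) : Submodule F (C ⊗[F] C) :=
  Submodule.span F {x : C ⊗[F] C | ∃ a : C, x = a ⊗ₜ[F] a - n a • ((1 : C) ⊗ₜ[F] (1 : C))}

/-- The involution `σ` of `C ⊗ C`: the tensor product of the standard involutions. -/
def sigmaT (F : Type*) [Field F] {C : Type*} [NonAssocRing C] [Module F C]
    (n : QuadraticForm F C) : C ⊗[F] C →ₗ[F] C ⊗[F] C :=
  TensorProduct.map (hconj F n) (hconj F n)

/-- An involution preserving `G`-grading of a subalgebra `T` of `A` (with involution `σ`):
a decomposition `T = ⊕_{g ∈ G} T_g` into independent subspaces with `T_g T_h ⊆ T_{g+h}`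
and `σ(T_g) ⊆ T_g`. -/
def IsInvolGradingOn (F : Type*) [Field F] {G : Type*} [AddCommGroup G] {A : Type*}
    [NonUnitalNonAssocRing A] [Module F A] (σ : A →ₗ[F] A)
    (T : Submodule F A) (𝒯 : G → Submodule F A) : Prop :=
  (∀ g : G, 𝒯 g ≤ T) ∧
    (∀ g : G, Disjoint (𝒯 g) (⨆ h : G, ⨆ _ : h ≠ g, 𝒯 h)) ∧
    (⨆ g : G, 𝒯 g) = T ∧
    (∀ ⦃g h : G⦄ ⦃x y : A⦄, x ∈ 𝒯 g → y ∈ 𝒯 h → x * y ∈ 𝒯 (g + h)) ∧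
    ∀ (g : G), ∀ x ∈ 𝒯 g, σ x ∈ 𝒯 g

/-- The `g`-component of the grading induced on the Smirnov algebra `T(C⊗C)` by a grading
`𝒞` on `C`: `T_g = T ∩ (Σ_{g₁+g₂=g} C_{g₁} ⊗ C_{g₂})`. -/
def smirnovComp (F : Type*) [Field F] {G : Type*} [AddCommGroup G] {C : Type*}
    [NonAssocRing C] [Module F C] (n : QuadraticForm F C)
    (𝒞 : G → Submodule F C) : G → Submodule F (C ⊗[F] C) :=
  fun g => smirnovT F n ⊓ ⨆ (p : G × G) (_ : p.1 + p.2 = g), tsub F (𝒞 p.1) (𝒞 p.2)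

namespace IsHurwitz

variable {F : Type*} [Field F] {B : Type*} [NonAssocRing B] [Module F B]
  {n : QuadraticForm F B}

theorem polar_mul_mul_left (hB : IsHurwitz F n) (x y z : B) :
    QuadraticMap.polar n (x * y) (x * z) = n x * QuadraticMap.polar n y z := by
  simp only [QuadraticMap.polar, ← mul_add, hB.2.2]
  ring

theorem polar_mul_mul_right (hB : IsHurwitz F n) (x y z : B) :
    QuadraticMap.polar n (x * z) (y * z) = QuadraticMap.polar n x y * n z := by
  simp only [QuadraticMap.polar, ← add_mul, hB.2.2]
  ring

theorem polar_mul_add_polar_mul (hB : IsHurwitz F n) (x y z w : B) :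
    QuadraticMap.polar n (x * y) (z * w) + QuadraticMap.polar n (x * w) (z * y) =
      QuadraticMap.polar n x z * QuadraticMap.polar n y w := by
  have h := hB.polar_mul_mul_right x z (y + w)
  rw [mul_add, mul_add, QuadraticMap.polar_add_left, QuadraticMap.polar_add_right,
    QuadraticMap.polar_add_right, hB.polar_mul_mul_right, hB.polar_mul_mul_right,
    QuadraticMap.map_add n y w] at h
  linear_combination h

/-- Every element of a Hurwitz algebra satisfies its quadratic characteristic equation. -/
theorem mul_self (hB : IsHurwitz F n) (x : B) :
    x * x = QuadraticMap.polar n x 1 • x - n x • (1 : B) := by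
  refine sub_eq_zero.mp (hB.2.1 _ fun y => ?_)
  have h₁ := hB.polar_mul_add_polar_mul x x 1 y
  have h₂ := hB.polar_mul_mul_left x y 1
  rw [one_mul, one_mul] at h₁
  rw [mul_one] at h₂
  simp only [QuadraticMap.polar_sub_left, QuadraticMap.polar_smul_left, smul_eq_mul,
    QuadraticMap.polar_comm n 1 y]
  linear_combination h₁ - h₂

theorem mul_add_mul_comm (hB : IsHurwitz F n) (x y : B) :
    x * y + y * x = QuadraticMap.polar n x 1 • y + QuadraticMap.polar n y 1 • x -
      QuadraticMap.polar n x y • (1 : B) := by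
  have h := hB.mul_self (x + y)
  rw [mul_add, add_mul, add_mul, hB.mul_self x, hB.mul_self y, QuadraticMap.polar_add_left,
    QuadraticMap.map_add n x y] at h
  linear_combination (norm := module) h

theorem map_one [Nontrivial B] (hB : IsHurwitz F n) : n 1 = 1 := by
  have h : n 1 = n 1 * n 1 := by rw [← hB.2.2, one_mul]
  rcases eq_or_ne (n 1) 0 with h0 | h0
  · have hz (x : B) : n x = 0 := by rw [← one_mul x, hB.2.2, h0, zero_mul]
    exact absurd (hB.2.1 1 fun y => by simp [QuadraticMap.polar, hz]) one_ne_zero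
  · exact (mul_left_cancel₀ h0 (by rw [mul_one, ← h])).symm

theorem polar_one_one [Nontrivial B] (hB : IsHurwitz F n) : QuadraticMap.polar n 1 1 = 2 := by
  rw [QuadraticMap.polar_self, hB.map_one, nsmul_eq_mul, mul_one, Nat.cast_ofNat]

theorem hconj_one [Nontrivial B] (hB : IsHurwitz F n) : hconj F n (1 : B) = 1 := by
  change QuadraticMap.polar n 1 1 • (1 : B) - 1 = 1
  rw [hB.polar_one_one, two_smul, add_sub_cancel_right]

theorem map_hconj [Nontrivial B] (hB : IsHurwitz F n) (x : B) : n (hconj F n x) = n x := by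
  change n (QuadraticMap.polar n x 1 • (1 : B) - x) = n x
  rw [sub_eq_add_neg, QuadraticMap.map_add n, QuadraticMap.map_smul, QuadraticMap.map_neg,
    QuadraticMap.polar_neg_right, QuadraticMap.polar_smul_left, hB.map_one,
    QuadraticMap.polar_comm n 1 x]
  simp only [smul_eq_mul]
  ring

end IsHurwitz

theorem polar_one_eq_zero_of_mem_skewPart {F : Type*} [Field F] {B : Type*} [NonAssocRing B]
    [Nontrivial B] [Module F B] {n : QuadraticForm F B} {x : B} (hx : x ∈ skewPart F n) :
    QuadraticMap.polar n x 1 = 0 := by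
  have h : QuadraticMap.polar n x 1 • (1 : B) - x = -x := hx
  rw [sub_eq_iff_eq_add, neg_add_cancel] at h
  exact (smul_eq_zero.mp h).resolve_right one_ne_zero

theorem mem_iSup_ne {F : Type*} [Field F] {G : Type*} {C : Type*} [AddCommGroup C] [Module F C]
    {𝒞 : G → Submodule F C} {g h : G} (hne : h ≠ g) {x : C} (hx : x ∈ 𝒞 h) :
    x ∈ ⨆ h : G, ⨆ _ : h ≠ g, 𝒞 h :=
  Submodule.mem_iSup_of_mem h (Submodule.mem_iSup_of_mem hne hx)

namespace IsGrading

variable {F : Type*} [Field F] {G : Type*} [AddCommGroup G] {C : Type*} [NonAssocRing C]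
  [Module F C] {𝒞 : G → Submodule F C}

theorem eq_zero_of_mem (h𝒞 : IsGrading F 𝒞) {g : G} {x : C} (hx : x ∈ 𝒞 g)
    (hx' : x ∈ ⨆ h : G, ⨆ _ : h ≠ g, 𝒞 h) : x = 0 :=
  Submodule.disjoint_def.mp (h𝒞.1 g) x hx hx'

@[elab_as_elim]
theorem induction_on (h𝒞 : IsGrading F 𝒞) {motive : C → Prop} (x : C)
    (mem : ∀ g, ∀ x ∈ 𝒞 g, motive x) (zero : motive 0)
    (add : ∀ x y, motive x → motive y → motive (x + y)) : motive x :=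
  Submodule.iSup_induction 𝒞 (motive := motive) (h𝒞.2.1 ▸ Submodule.mem_top : x ∈ ⨆ g, 𝒞 g) mem zero add

theorem one_mem (h𝒞 : IsGrading F 𝒞) : (1 : C) ∈ 𝒞 0 := by
  have htop : (1 : C) ∈ 𝒞 0 ⊔ ⨆ h : G, ⨆ _ : h ≠ 0, 𝒞 h := by
    have hle : (⨆ g, 𝒞 g) ≤ 𝒞 0 ⊔ ⨆ h : G, ⨆ _ : h ≠ 0, 𝒞 h := by
      refine iSup_le fun g => ?_
      rcases eq_or_ne g 0 with rfl | hg
      · exact le_sup_left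
      · exact fun x hx => le_sup_right (a := 𝒞 0) (mem_iSup_ne hg hx)
    exact hle (h𝒞.2.1 ▸ Submodule.mem_top)
  obtain ⟨e, he, r, hr, her⟩ := Submodule.mem_sup.mp htop
  have hmul (x : C) : r * x = 0 := by
    refine h𝒞.induction_on x (fun g x hx => ?_) (mul_zero r) fun x y hx hy => by
      rw [mul_add, hx, hy, add_zero]
    refine h𝒞.eq_zero_of_mem (g := g) ?_ ?_
    · have hrx : r * x = x - e * x := by
        rw [eq_sub_iff_add_eq, ← add_mul, add_comm r e, her, one_mul]
      rw [hrx]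
      refine sub_mem hx ?_
      simpa using h𝒞.2.2 he hx
    · refine Submodule.iSup_induction _
        (motive := fun r => r * x ∈ ⨆ h : G, ⨆ _ : h ≠ g, 𝒞 h) hr (fun h y hy => ?_)
        (by rw [zero_mul]; exact zero_mem _) fun y z hy hz => by
          rw [add_mul]; exact add_mem hy hz
      by_cases hh : h = 0
      · simp [hh] at hy
        simp [hy]
      · simp only [ne_eq, hh, not_false_eq_true, iSup_pos] at hy
        exact mem_iSup_ne (by simpa using hh) (h𝒞.2.2 hy hx)
  rw [← her, ← mul_one r, hmul, add_zero]
  exact he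

variable {n : QuadraticForm F C}

theorem polar_one_eq_zero (h𝒞 : IsGrading F 𝒞) (hC : IsHurwitz F n) {g : G} (hg : g ≠ 0) {x : C}
    (hx : x ∈ 𝒞 g) : QuadraticMap.polar n x 1 = 0 := by
  have h : QuadraticMap.polar n x 1 • x = 0 := by
    refine h𝒞.eq_zero_of_mem (g := g) (Submodule.smul_mem _ _ hx) ?_
    have he : QuadraticMap.polar n x 1 • x = x * x + n x • (1 : C) := by
      rw [hC.mul_self, sub_add_cancel]
    rw [he]
    exact add_mem (mem_iSup_ne (by simpa using hg) (h𝒞.2.2 hx hx))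
      (mem_iSup_ne hg.symm (Submodule.smul_mem _ _ h𝒞.one_mem))
  rcases smul_eq_zero.mp h with h | rfl
  · exact h
  · exact QuadraticMap.polar_zero_left n 1

/-- Homogeneous components whose degrees do not add up to zero are orthogonal. -/
theorem polar_eq_zero [Nontrivial C] (h𝒞 : IsGrading F 𝒞) (hC : IsHurwitz F n) {g h : G}
    (hgh : g + h ≠ 0) {x y : C} (hx : x ∈ 𝒞 g) (hy : y ∈ 𝒞 h) :
    QuadraticMap.polar n x y = 0 := by
  have hterm : ∀ {k l : G} {u v : C}, u ∈ 𝒞 k → v ∈ 𝒞 l →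
      QuadraticMap.polar n u 1 • v ∈ 𝒞 (k + l) := by
    intro k l u v hu hv
    rcases eq_or_ne k 0 with rfl | hk
    · rw [zero_add]
      exact Submodule.smul_mem _ _ hv
    · rw [h𝒞.polar_one_eq_zero hC hk hu, zero_smul]
      exact zero_mem _
  have he : QuadraticMap.polar n x y • (1 : C) = QuadraticMap.polar n x 1 • y +
      QuadraticMap.polar n y 1 • x - (x * y + y * x) := by
    rw [hC.mul_add_mul_comm, sub_sub_cancel]
  have hz : QuadraticMap.polar n x y • (1 : C) = 0 := by
    refine h𝒞.eq_zero_of_mem (Submodule.smul_mem _ _ h𝒞.one_mem) (mem_iSup_ne hgh ?_)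
    rw [he]
    have h₁ := hterm hy hx
    have h₂ := h𝒞.2.2 hy hx
    rw [add_comm h g] at h₁ h₂
    exact sub_mem (add_mem (hterm hx hy) h₁) (add_mem (h𝒞.2.2 hx hy) h₂)
  exact (smul_eq_zero.mp hz).resolve_right one_ne_zero

theorem hconj_mem (h𝒞 : IsGrading F 𝒞) (hC : IsHurwitz F n) {g : G} {x : C} (hx : x ∈ 𝒞 g) :
    hconj F n x ∈ 𝒞 g := by
  refine sub_mem ?_ hx
  rcases eq_or_ne g 0 with rfl | hg
  · exact Submodule.smul_mem _ _ h𝒞.one_mem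
  · rw [h𝒞.polar_one_eq_zero hC hg hx, zero_smul]
    exact zero_mem _

/-- There is a linear map sending each homogeneous element `x` of degree `g` to
`Finsupp.single g x`. -/
theorem exists_decomposition (h𝒞 : IsGrading F 𝒞) :
    ∃ δ : C →ₗ[F] G →₀ C, ∀ g, ∀ x ∈ 𝒞 g, δ x = Finsupp.single g x := by
  classical
  have hint : DirectSum.IsInternal 𝒞 :=
    DirectSum.isInternal_submodule_of_iSupIndep_of_iSup_eq_top h𝒞.1 h𝒞.2.1
  let := hint.chooseDecomposition
  refine ⟨(DirectSum.toModule F G (G →₀ C) fun g => Finsupp.lsingle g ∘ₗ (𝒞 g).subtype) ∘ₗ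
    (DirectSum.decomposeLinearEquiv 𝒞).toLinearMap, fun g x hx => ?_⟩
  rw [LinearMap.comp_apply, LinearEquiv.coe_coe, DirectSum.decomposeLinearEquiv_apply,
    DirectSum.decompose_of_mem 𝒞 hx, ← DirectSum.lof_eq_of F, DirectSum.toModule_lof]
  simp

end IsGrading

/-- The component of degree `g` of the grading on `C ⊗ C` induced by `𝒞`. -/
def tensorComp {F : Type*} [Field F] {G : Type*} [AddCommGroup G] {C : Type*}
    [NonAssocRing C] [Module F C] (𝒞 : G → Submodule F C) (g : G) : Submodule F (C ⊗[F] C) :=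
  ⨆ (p : G × G) (_ : p.1 + p.2 = g), tsub F (𝒞 p.1) (𝒞 p.2)

section tensorComp

variable {F : Type*} [Field F] {G : Type*} [AddCommGroup G] {C : Type*} [NonAssocRing C]
  [Module F C] {𝒞 : G → Submodule F C}

theorem tmul_mem_tensorComp {g h k : G} (hk : g + h = k) {x y : C} (hx : x ∈ 𝒞 g)
    (hy : y ∈ 𝒞 h) : x ⊗ₜ[F] y ∈ tensorComp 𝒞 k :=
  Submodule.mem_iSup_of_mem (g, h) (Submodule.mem_iSup_of_mem hk
    ⟨(⟨x, hx⟩ : 𝒞 g) ⊗ₜ[F] (⟨y, hy⟩ : 𝒞 h), rfl⟩)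

@[elab_as_elim]
theorem tensorComp_induction {k : G} {motive : C ⊗[F] C → Prop} {t : C ⊗[F] C}
    (ht : t ∈ tensorComp 𝒞 k)
    (tmul : ∀ g h, g + h = k → ∀ x ∈ 𝒞 g, ∀ y ∈ 𝒞 h, motive (x ⊗ₜ[F] y)) (zero : motive 0)
    (add : ∀ s t, motive s → motive t → motive (s + t)) : motive t := by
  refine Submodule.iSup_induction _ (motive := motive) ht (fun p t ht => ?_) zero add
  refine Submodule.iSup_induction _ (motive := motive) ht (fun hp t ht => ?_) zero add
  obtain ⟨u, rfl⟩ := ht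
  induction u using TensorProduct.induction_on with
  | zero => simpa using zero
  | tmul x y => exact tmul p.1 p.2 hp x x.2 y y.2
  | add u v hu hv =>
    rw [map_add]
    exact add _ _ hu hv

theorem mul_mem_tensorComp [SMulCommClass F C C] [IsScalarTower F C C] (h𝒞 : IsGrading F 𝒞)
    {k l : G} {s t : C ⊗[F] C} (hs : s ∈ tensorComp 𝒞 k) (ht : t ∈ tensorComp 𝒞 l) :
    s * t ∈ tensorComp 𝒞 (k + l) := by
  refine tensorComp_induction hs (fun g h hgh x hx y hy => ?_)
    (by rw [zero_mul]; exact zero_mem _) fun u v hu hv => by rw [add_mul]; exact add_mem hu hv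
  refine tensorComp_induction ht (fun g' h' hgh' x' hx' y' hy' => ?_)
    (by rw [mul_zero]; exact zero_mem _) fun u v hu hv => by rw [mul_add]; exact add_mem hu hv
  rw [Algebra.TensorProduct.tmul_mul_tmul]
  exact tmul_mem_tensorComp (by rw [← hgh, ← hgh']; abel) (h𝒞.2.2 hx hx') (h𝒞.2.2 hy hy')

theorem sigmaT_mem_tensorComp {n : QuadraticForm F C} (h𝒞 : IsGrading F 𝒞) (hC : IsHurwitz F n)
    {k : G} {t : C ⊗[F] C} (ht : t ∈ tensorComp 𝒞 k) : sigmaT F n t ∈ tensorComp 𝒞 k :=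
  tensorComp_induction ht
    (fun _ _ hgh _ hx _ hy => by
      rw [sigmaT, TensorProduct.map_tmul]
      exact tmul_mem_tensorComp hgh (h𝒞.hconj_mem hC hx) (h𝒞.hconj_mem hC hy))
    (by rw [map_zero]; exact zero_mem _) fun u v hu hv => by rw [map_add]; exact add_mem hu hv

theorem disjoint_tensorComp (h𝒞 : IsGrading F 𝒞) (g : G) :
    Disjoint (tensorComp 𝒞 g) (⨆ h : G, ⨆ _ : h ≠ g, tensorComp 𝒞 h) := by
  classical
  obtain ⟨δ, hδ⟩ := h𝒞.exists_decomposition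
  let D : C ⊗[F] C →ₗ[F] G →₀ C ⊗[F] C :=
    Finsupp.lmapDomain (C ⊗[F] C) F (fun p : G × G => p.1 + p.2) ∘ₗ
      (finsuppTensorFinsupp F F C C G G).toLinearMap ∘ₗ TensorProduct.map δ δ
  have hD : ∀ {k : G} {t : C ⊗[F] C}, t ∈ tensorComp 𝒞 k → D t = Finsupp.single k t := by
    intro k t ht
    refine tensorComp_induction ht (fun a b hab x hx y hy => ?_) (by simp)
      fun u v hu hv => by rw [map_add, hu, hv, Finsupp.single_add]
    simp [D, hδ a x hx, hδ b y hy, finsuppTensorFinsupp_single, Finsupp.mapDomain_single, hab]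
  refine Submodule.disjoint_def.mpr fun t ht ht' => ?_
  have hle : (⨆ h : G, ⨆ _ : h ≠ g, tensorComp 𝒞 h) ≤ LinearMap.ker (Finsupp.lapply g ∘ₗ D) := by
    refine iSup₂_le fun h hne u hu => ?_
    simp [hD hu, Finsupp.single_eq_of_ne' hne]
  have h0 : D t g = 0 := hle ht'
  rwa [hD ht, Finsupp.single_eq_same] at h0

end tensorComp

section Smirnov

variable {F : Type*} [Field F] {C : Type*} [NonAssocRing C] [Module F C]
  (n : QuadraticForm F C)

/-- The polarization of the quadratic map `a ↦ a ⊗ a - n(a) 1 ⊗ 1` spanning the Smirnov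
algebra. -/
def smirnovPolar (a b : C) : C ⊗[F] C :=
  a ⊗ₜ[F] b + b ⊗ₜ[F] a - QuadraticMap.polar n a b • ((1 : C) ⊗ₜ[F] (1 : C))

theorem smirnovPolar_add_left (a b c : C) :
    smirnovPolar n (a + b) c = smirnovPolar n a c + smirnovPolar n b c := by
  simp only [smirnovPolar, TensorProduct.add_tmul, TensorProduct.tmul_add,
    QuadraticMap.polar_add_left, add_smul]
  abel

theorem smirnovPolar_comm (a b : C) : smirnovPolar n a b = smirnovPolar n b a := by
  rw [smirnovPolar, smirnovPolar, QuadraticMap.polar_comm, add_comm (a ⊗ₜ[F] b)]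

theorem smirnovPolar_zero_left (a : C) : smirnovPolar n 0 a = 0 := by
  simp [smirnovPolar]

theorem smirnovPolar_self (a : C) :
    smirnovPolar n a a = (2 : F) • (a ⊗ₜ[F] a - n a • ((1 : C) ⊗ₜ[F] (1 : C))) := by
  rw [smirnovPolar, QuadraticMap.polar_self, two_nsmul]
  module

theorem smirnovPolar_mem (a b : C) : smirnovPolar n a b ∈ smirnovT F n := by
  have h : smirnovPolar n a b =
      ((a + b) ⊗ₜ[F] (a + b) - n (a + b) • ((1 : C) ⊗ₜ[F] (1 : C))) -
        (a ⊗ₜ[F] a - n a • ((1 : C) ⊗ₜ[F] (1 : C))) -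
        (b ⊗ₜ[F] b - n b • ((1 : C) ⊗ₜ[F] (1 : C))) := by
    simp only [smirnovPolar, TensorProduct.add_tmul, TensorProduct.tmul_add,
      QuadraticMap.map_add n a b, add_smul]
    abel
  rw [h]
  exact sub_mem (sub_mem (Submodule.subset_span ⟨_, rfl⟩) (Submodule.subset_span ⟨_, rfl⟩))
    (Submodule.subset_span ⟨_, rfl⟩)

variable {n}

theorem mul_mem_smirnovT [SMulCommClass F C C] [IsScalarTower F C C] (hC : IsHurwitz F n)
    {s t : C ⊗[F] C} (hs : s ∈ smirnovT F n) (ht : t ∈ smirnovT F n) :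
    s * t ∈ smirnovT F n := by
  induction hs using Submodule.span_induction with
  | zero => rw [zero_mul]; exact zero_mem _
  | add u v _ _ hu hv => rw [add_mul]; exact add_mem hu hv
  | smul c u _ hu => rw [smul_mul_assoc]; exact Submodule.smul_mem _ _ hu
  | mem s hs =>
    obtain ⟨a, rfl⟩ := hs
    induction ht using Submodule.span_induction with
    | zero => rw [mul_zero]; exact zero_mem _
    | add u v _ _ hu hv => rw [mul_add]; exact add_mem hu hv
    | smul c u _ hu => rw [mul_smul_comm]; exact Submodule.smul_mem _ _ hu
    | mem t ht =>
      obtain ⟨b, rfl⟩ := ht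
      have h : (a ⊗ₜ[F] a - n a • ((1 : C) ⊗ₜ[F] (1 : C))) *
          (b ⊗ₜ[F] b - n b • ((1 : C) ⊗ₜ[F] (1 : C))) =
          ((a * b) ⊗ₜ[F] (a * b) - n (a * b) • ((1 : C) ⊗ₜ[F] (1 : C))) -
            n a • (b ⊗ₜ[F] b - n b • ((1 : C) ⊗ₜ[F] (1 : C))) -
            n b • (a ⊗ₜ[F] a - n a • ((1 : C) ⊗ₜ[F] (1 : C))) := by
        simp only [sub_mul, mul_sub, smul_mul_assoc, mul_smul_comm,
          Algebra.TensorProduct.tmul_mul_tmul, one_mul, mul_one, hC.2.2]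
        module
      rw [h]
      exact sub_mem (sub_mem (Submodule.subset_span ⟨_, rfl⟩)
        (Submodule.smul_mem _ _ (Submodule.subset_span ⟨_, rfl⟩)))
        (Submodule.smul_mem _ _ (Submodule.subset_span ⟨_, rfl⟩))

theorem sigmaT_mem_smirnovT [Nontrivial C] (hC : IsHurwitz F n) {t : C ⊗[F] C}
    (ht : t ∈ smirnovT F n) : sigmaT F n t ∈ smirnovT F n := by
  suffices h : smirnovT F n ≤ (smirnovT F n).comap (sigmaT F n) from h ht
  refine Submodule.span_le.mpr ?_
  rintro _ ⟨a, rfl⟩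
  refine Submodule.subset_span ⟨hconj F n a, ?_⟩
  simp only [sigmaT, map_sub, map_smul, TensorProduct.map_tmul, hC.hconj_one, hC.map_hconj]

variable {G : Type*} [AddCommGroup G] {𝒞 : G → Submodule F C}

theorem smirnovPolar_mem_smirnovComp [Nontrivial C] (h𝒞 : IsGrading F 𝒞) (hC : IsHurwitz F n)
    {g h : G} {x y : C} (hx : x ∈ 𝒞 g) (hy : y ∈ 𝒞 h) :
    smirnovPolar n x y ∈ smirnovComp F n 𝒞 (g + h) := by
  refine ⟨smirnovPolar_mem n x y, ?_⟩
  change smirnovPolar n x y ∈ tensorComp 𝒞 (g + h)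
  refine sub_mem (add_mem (tmul_mem_tensorComp rfl hx hy)
    (tmul_mem_tensorComp (add_comm h g) hy hx)) ?_
  by_cases hgh : g + h = 0
  · rw [hgh]
    exact Submodule.smul_mem _ _ (tmul_mem_tensorComp (add_zero 0) h𝒞.one_mem h𝒞.one_mem)
  · rw [h𝒞.polar_eq_zero hC hgh hx hy, zero_smul]
    exact zero_mem _

theorem iSup_smirnovComp [Nontrivial C] (hF : (2 : F) ≠ 0) (h𝒞 : IsGrading F 𝒞)
    (hC : IsHurwitz F n) : (⨆ g, smirnovComp F n 𝒞 g) = smirnovT F n := by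
  refine le_antisymm (iSup_le fun g => inf_le_left) (Submodule.span_le.mpr ?_)
  have hpolar (a b : C) : smirnovPolar n a b ∈ ⨆ g, smirnovComp F n 𝒞 g := by
    refine h𝒞.induction_on a (fun g x hx => ?_)
      (by rw [smirnovPolar_zero_left]; exact zero_mem _)
      fun x y hx hy => by rw [smirnovPolar_add_left]; exact add_mem hx hy
    rw [smirnovPolar_comm]
    refine h𝒞.induction_on b (fun h y hy => ?_)
      (by rw [smirnovPolar_zero_left]; exact zero_mem _)
      fun x y hx hy => by rw [smirnovPolar_add_left]; exact add_mem hx hy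
    exact Submodule.mem_iSup_of_mem _ (smirnovPolar_mem_smirnovComp h𝒞 hC hy hx)
  rintro _ ⟨a, rfl⟩
  have h := hpolar a a
  rw [smirnovPolar_self] at h
  exact (Submodule.smul_mem_iff _ hF).mp h

end Smirnov

/-- Let `C` be a Cayley algebra over a field `F` of characteristic `≠ 2`,
`T = T(C⊗C)` the Smirnov algebra with involution, and `Γ : C = ⊕_g C_g` a `G`-grading on
`C`.  Setting `T_g = T ∩ (Σ_{g₁+g₂=g} C_{g₁} ⊗ C_{g₂})` yields an involution preserving
`G`-grading on `T`, whose degree map satisfies `deg(s⊗1 + 1⊗s) = deg_Γ(s)` and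
`deg(s₁⊗s₂ + s₂⊗s₁ - n(s₁,s₂)·1⊗1) = deg_Γ(s₁) + deg_Γ(s₂)` for homogeneous skew
elements `s, s₁, s₂`. -/
theorem smirnov_induced_grading (F : Type*) [Field F] (hF : (2 : F) ≠ 0)
    (C : Type*) [NonAssocRing C] [Module F C] [SMulCommClass F C C] [IsScalarTower F C C]
    (n : QuadraticForm F C) (hC : IsHurwitz F n) (hdim : Module.finrank F C = 8)
    (G : Type*) [AddCommGroup G] (𝒞 : G → Submodule F C) (hgr : IsGrading F 𝒞) :
    IsInvolGradingOn F (sigmaT F n) (smirnovT F n) (smirnovComp F n 𝒞) ∧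
    (∀ (g : G) (s : C), s ∈ skewPart F n → s ∈ 𝒞 g →
      s ⊗ₜ[F] (1 : C) + (1 : C) ⊗ₜ[F] s ∈ smirnovComp F n 𝒞 g) ∧
    (∀ (g₁ g₂ : G) (s₁ s₂ : C), s₁ ∈ skewPart F n → s₂ ∈ skewPart F n →
      s₁ ∈ 𝒞 g₁ → s₂ ∈ 𝒞 g₂ →
      s₁ ⊗ₜ[F] s₂ + s₂ ⊗ₜ[F] s₁ - QuadraticMap.polar n s₁ s₂ • ((1 : C) ⊗ₜ[F] (1 : C)) ∈
        smirnovComp F n 𝒞 (g₁ + g₂)) := by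
  have : Nontrivial C := Module.nontrivial_of_finrank_pos (R := F) (by omega)
  refine ⟨⟨fun g => inf_le_left, fun g => ?_, iSup_smirnovComp hF hgr hC,
    fun g h x y hx hy => ⟨mul_mem_smirnovT hC hx.1 hy.1, mul_mem_tensorComp hgr hx.2 hy.2⟩,
    fun g x hx => ⟨sigmaT_mem_smirnovT hC hx.1, sigmaT_mem_tensorComp hgr hC hx.2⟩⟩,
    fun g s hs hsg => ?_,
    fun g₁ g₂ s₁ s₂ _ _ h₁ h₂ => smirnovPolar_mem_smirnovComp hgr hC h₁ h₂⟩
  · exact (disjoint_tensorComp hgr g).mono inf_le_right (iSup₂_mono fun h _ => inf_le_right)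
  · have h := smirnovPolar_mem_smirnovComp hgr hC hsg hgr.one_mem
    rwa [smirnovPolar, polar_one_eq_zero_of_mem_skewPart hs, zero_smul, sub_zero,
      add_zero] at h
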